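/- arXiv:1903.07341 — 2 statements merged into one kernel-verified Lean document; each statement's English description precedes it below -/
import Mathlib

section
/- There exists an absolute constant C₀ > 0 with the following property: for every nonconstant harmonic function u : ℂ → ℝ there exist sequences z_n ∈ ℂ and r_n > 0 such that for all n: u(z_n) = 0, M(u, z_n, r_n) → +∞ as n → ∞, and M(|u|, z_n, r_n) ≤ C₀·M(u, z_n, (3/4)·r_n). -/
open Complex Metric Filter Set

/-- A function `u : ℂ → ℝ` is harmonic on all of `ℂ` if it is `C²` and its Laplacian
(the sum of the second derivatives in the directions `1` and `I`) vanishes everywhere. -/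
def HarmonicFn (u : ℂ → ℝ) : Prop :=
  ContDiff ℝ 2 u ∧
    ∀ z : ℂ, iteratedFDeriv ℝ 2 u z ![1, 1] + iteratedFDeriv ℝ 2 u z ![Complex.I, Complex.I] = 0

/-- A function `u : ℂ → ℝ` is harmonic on a set `s` if it is `C²` on `s` and its Laplacian
vanishes on `s`. -/
def HarmonicOnSet (u : ℂ → ℝ) (s : Set ℂ) : Prop :=
  ContDiffOn ℝ 2 u s ∧
    ∀ z ∈ s, iteratedFDerivWithin ℝ 2 u s z ![1, 1]
      + iteratedFDerivWithin ℝ 2 u s z ![Complex.I, Complex.I] = 0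

/-- The set of asymptotic directions of a set `R ⊆ ℂ`: points `ζ` of the unit circle for which
there are `w n ∈ R` and positive `ε n → 0` with `ε n * w n → ζ`. -/
def asympDirs (R : Set ℂ) : Set ℂ :=
  {ζ : ℂ | ‖ζ‖ = 1 ∧ ∃ w : ℕ → ℂ, (∀ n, w n ∈ R) ∧ ∃ ε : ℕ → ℝ,
    (∀ n, 0 < ε n) ∧ Tendsto ε atTop (nhds 0) ∧
    Tendsto (fun n => (ε n : ℂ) * w n) atTop (nhds ζ)}

/-- `supOn u z r` is `M(u,z,r) = sup {u w : |w - z| ≤ r}`. -/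
noncomputable def supOn (u : ℂ → ℝ) (z : ℂ) (r : ℝ) : ℝ :=
  sSup (u '' Metric.closedBall z r)

/-- Subharmonic: upper semicontinuous and lies below every harmonic function dominating it on
the boundary of any disc. -/
def SubharmonicFn (w : ℂ → ℝ) : Prop :=
  UpperSemicontinuous w ∧
    ∀ (z₀ : ℂ) (r : ℝ), 0 < r → ∀ h : ℂ → ℝ,
      HarmonicOnSet h (Metric.ball z₀ r) → ContinuousOn h (Metric.closedBall z₀ r) →
      (∀ ζ ∈ Metric.sphere z₀ r, w ζ ≤ h ζ) → ∀ ζ ∈ Metric.closedBall z₀ r, w ζ ≤ h ζ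

theorem HarmonicFn.exists_re_eq {u : ℂ → ℝ} (hu : HarmonicFn u) :
    ∃ f : ℂ → ℂ, Differentiable ℂ f ∧ ∀ z, u z = (f z).re := by
  have h : InnerProductSpace.HarmonicOnNhd u univ := by
    refine fun x _ => ⟨hu.1.contDiffAt, Eventually.of_forall fun z => ?_⟩
    rw [InnerProductSpace.laplacian_eq_iteratedFDeriv_complexPlane]
    exact hu.2 z
  obtain ⟨f, hf, hfu⟩ := h.exists_analyticOnNhd_univ_re_eq
  exact ⟨f, fun z => (hf z (mem_univ z)).differentiableAt, fun z => (congrFun hfu z).symm⟩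

/-- An entire function whose real part is bounded above has constant real part. -/
theorem re_eq_of_forall_re_le {f : ℂ → ℂ} (hf : Differentiable ℂ f) {M : ℝ}
    (hM : ∀ z, (f z).re ≤ M) (z w : ℂ) : (f z).re = (f w).re := by
  have h : Complex.exp (f z) = Complex.exp (f w) := by
    refine Differentiable.apply_eq_apply_of_bounded (f := fun z => Complex.exp (f z))
      hf.cexp ?_ z w
    refine isBounded_iff_forall_norm_le.2 ⟨Real.exp M, ?_⟩
    rintro _ ⟨x, rfl⟩
    simpa [Complex.norm_exp] using hM x
  simpa [Complex.norm_exp] using congrArg norm h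

/-- Harnack's inequality for the real part of an entire function that is at most `A` on a disc. -/
theorem sub_re_le_of_forall_re_le {f : ℂ → ℂ} (hf : Differentiable ℂ f) {A R : ℝ} {c w : ℂ}
    (hR : 0 < R) (hA : (f c).re < A) (hb : ∀ z ∈ ball c R, (f z).re ≤ A)
    (hw : dist w c ≤ R / 2) : A - (f w).re ≤ 3 * (A - (f c).re) := by
  have hM : 0 < A - (f c).re := sub_pos.2 hA
  have hwn : ‖w - c‖ ≤ R / 2 := by rwa [← dist_eq_norm]
  have key := Complex.borelCaratheodory_zero (f := fun z => f (c + z) - f c) (R := R)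
    (z := w - c) hM (by fun_prop) (fun z hz => by
      have := hb (c + z) (by simpa [dist_eq_norm] using hz)
      simp only [mem_ofPred_eq, Complex.sub_re]
      linarith) hR (by simp; linarith) (by simp)
  rw [add_sub_cancel] at key
  have h1 : 2 * (A - (f c).re) * ‖w - c‖ / (R - ‖w - c‖) ≤ 2 * (A - (f c).re) := by
    rw [div_le_iff₀ (by linarith)]
    exact mul_le_mul_of_nonneg_left (by linarith) (by linarith)
  have h2 := (abs_le.1 (Complex.abs_re_le_norm (f w - f c))).1
  rw [Complex.sub_re] at h2
  linarith

/-- Harnack's inequality for the positive real part of an entire function. -/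
theorem re_le_of_forall_re_pos {f : ℂ → ℂ} (hf : Differentiable ℂ f) {R : ℝ} {c w : ℂ}
    (hR : 0 < R) (hb : ∀ z ∈ ball c R, 0 < (f z).re) (hw : dist w c ≤ R / 2) :
    (f w).re ≤ 3 * (f c).re := by
  have h := sub_re_le_of_forall_re_le (f := fun z => -f z) (A := 0) hf.neg hR
    (by simpa using hb c (mem_ball_self hR)) (fun z hz => by simpa using (hb z hz).le) hw
  simpa using h

/-- Suppose `F` bounds the real part of `f` on `closedBall z ((R - ‖z‖) / 8)` for every zero `z`
of `f.re` in the disc of radius `R`. Then, around one such zero, multiples of `F` bound it on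
slightly larger discs. -/
theorem re_le_pow_mul_of_forall_zero {f : ℂ → ℂ} (hf : Differentiable ℂ f) {F R ρ : ℝ} {z₁ : ℂ}
    (hF : 0 ≤ F) (hρ : 0 < ρ) (hz₁ : (f z₁).re = 0) (hρR : ρ = (R - ‖z₁‖) / 8)
    (hmax : ∀ z w, (f z).re = 0 → ‖z‖ ≤ R → dist w z ≤ (R - ‖z‖) / 8 → (f w).re ≤ F)
    (k : ℕ) (hk : k ≤ 14) {w : ℂ} (hw : dist w z₁ ≤ ρ * (1 + k / 8)) :
    (f w).re ≤ 3 ^ k * F := by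
  induction k generalizing w with
  | zero =>
    have := hmax z₁ w hz₁ (by linarith) (by rw [← hρR]; simpa using hw)
    simpa using this
  | succ k ih =>
    have hk' : (k : ℝ) + 1 ≤ 14 := by exact_mod_cast hk
    push_cast at hw
    have hwle : dist w z₁ ≤ ρ * (11 / 4) :=
      hw.trans (mul_le_mul_of_nonneg_left (by linarith) hρ.le)
    have hFle : F ≤ 3 ^ (k + 1) * F :=
      le_mul_of_one_le_left hF (one_le_pow₀ (by norm_num))
    rcases le_or_gt (dist w z₁) ρ with hnear | hfar
    · exact (hmax z₁ w hz₁ (by linarith) (by rwa [← hρR])).trans hFle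
    rcases le_or_gt (f w).re 0 with hneg | hpos
    · exact hneg.trans (hF.trans hFle)
    by_cases hex : ∃ z ∈ ball w (ρ / 2), (f z).re ≤ 0
    · obtain ⟨z, hz, hz0⟩ := hex
      obtain ⟨y, hy, hy0⟩ : (0 : ℝ) ∈ (fun z => (f z).re) '' ball w (ρ / 2) :=
        (convex_ball w (ρ / 2)).isPreconnected.intermediate_value hz
          (mem_ball_self (by linarith))
          (Complex.continuous_re.comp hf.continuous).continuousOn ⟨hz0, hpos.le⟩
      rw [mem_ball] at hy
      have h1 : ‖y‖ ≤ ‖z₁‖ + dist y z₁ := by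
        rw [dist_eq_norm]
        simpa using norm_add_le z₁ (y - z₁)
      have h2 := dist_triangle y w z₁
      exact (hmax y w hy0 (by linarith) (by rw [dist_comm]; linarith)).trans hFle
    · push Not at hex
      set d := dist w z₁ with hd
      have hd0 : 0 < d := hρ.trans hfar
      set t := ρ / (8 * d) with ht
      have ht0 : 0 ≤ t := by positivity
      have htd : t * d = ρ / 8 := by rw [ht]; field_simp
      have ht1 : t ≤ 1 := by rw [ht, div_le_one (by positivity)]; linarith
      have h1 : dist (AffineMap.lineMap w z₁ t) w = ρ / 8 := by
        rw [dist_lineMap_left, Real.norm_of_nonneg ht0, htd]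
      have h2 : dist (AffineMap.lineMap w z₁ t) z₁ = d - ρ / 8 := by
        rw [dist_lineMap_right, Real.norm_of_nonneg (by linarith), ← htd]
        ring
      have hstep := re_le_of_forall_re_pos hf (R := ρ / 4) (c := AffineMap.lineMap w z₁ t)
        (w := w) (by linarith) (fun z hz => hex z (by
          rw [mem_ball] at hz ⊢
          linarith [dist_triangle z (AffineMap.lineMap w z₁ t) w]))
        (by rw [dist_comm]; linarith)
      have hprev := ih (by omega) (w := AffineMap.lineMap w z₁ t) (by rw [h2]; linarith)
      rw [pow_succ]
      linarith

/-- Among all zeros `z` of a continuous function in a disc, some zero and some point of the disc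
around it of radius proportional to the distance from `z` to the boundary realise the largest
value. -/
theorem exists_zero_forall_le {u : ℂ → ℝ} (hu : Continuous u) {R : ℝ} {z₀ : ℂ} (hz₀ : u z₀ = 0)
    (hR : ‖z₀‖ ≤ R) :
    ∃ z₁ w₁, u z₁ = 0 ∧ ‖z₁‖ ≤ R ∧ dist w₁ z₁ ≤ (R - ‖z₁‖) / 8 ∧
      ∀ z w, u z = 0 → ‖z‖ ≤ R → dist w z ≤ (R - ‖z‖) / 8 → u w ≤ u w₁ := by
  let K : Set (ℂ × ℂ) := {p | u p.1 = 0 ∧ ‖p.1‖ ≤ R ∧ dist p.2 p.1 ≤ (R - ‖p.1‖) / 8}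
  have hclosed : IsClosed K := by
    have h1 : IsClosed {p : ℂ × ℂ | u p.1 = 0} := isClosed_eq (by fun_prop) (by fun_prop)
    have h2 : IsClosed {p : ℂ × ℂ | ‖p.1‖ ≤ R} := isClosed_le (by fun_prop) (by fun_prop)
    have h3 : IsClosed {p : ℂ × ℂ | dist p.2 p.1 ≤ (R - ‖p.1‖) / 8} :=
      isClosed_le (by fun_prop) (by fun_prop)
    exact h1.inter (h2.inter h3)
  have hsub : K ⊆ closedBall 0 R ×ˢ closedBall 0 (2 * R) := by
    rintro ⟨z, w⟩ ⟨-, h2, h3⟩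
    simp only at h2 h3
    have h4 := norm_add_le (w - z) z
    rw [sub_add_cancel, ← dist_eq_norm] at h4
    have := norm_nonneg z
    simp only [mem_prod, mem_closedBall, dist_zero_right]
    exact ⟨h2, by linarith⟩
  have hK : IsCompact K :=
    ((isCompact_closedBall _ _).prod (isCompact_closedBall _ _)).of_isClosed_subset hclosed hsub
  obtain ⟨⟨z₁, w₁⟩, ⟨h1, h2, h3⟩, hmax⟩ := hK.exists_isMaxOn
    ⟨(z₀, z₀), hz₀, hR, by simp only [dist_self]; linarith⟩
    (f := fun p => u p.2) (hu.comp continuous_snd).continuousOn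
  exact ⟨z₁, w₁, h1, h2, h3, fun z w hz hzR hw => hmax (a := (z, w)) ⟨hz, hzR, hw⟩⟩

theorem le_supOn {u : ℂ → ℝ} (hu : Continuous u) {z w : ℂ} {r : ℝ} (hw : dist w z ≤ r) :
    u w ≤ supOn u z r :=
  le_csSup ((isCompact_closedBall z r).image hu).bddAbove ⟨w, hw, rfl⟩

theorem supOn_le {u : ℂ → ℝ} {z : ℂ} {r A : ℝ} (hr : 0 ≤ r) (h : ∀ w, dist w z ≤ r → u w ≤ A) :
    supOn u z r ≤ A := by
  refine csSup_le ((nonempty_closedBall.2 hr).image u) ?_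
  rintro _ ⟨w, hw, rfl⟩
  exact h w hw

/-- The real part of an entire function with real part unbounded above and with a zero satisfies a
doubling condition on some disc centred at a zero, where it is as large as we please. -/
theorem exists_doubling_disc {f : ℂ → ℂ} (hf : Differentiable ℂ f)
    (hunb : ∀ M, ∃ z, M < (f z).re) {z₀ : ℂ} (hz₀ : (f z₀).re = 0) (N : ℝ) :
    ∃ z r, 0 < r ∧ (f z).re = 0 ∧ N ≤ supOn (fun w => (f w).re) z r ∧
      supOn (fun w => |(f w).re|) z r ≤
        2 * 3 ^ 14 * supOn (fun w => (f w).re) z (3 / 4 * r) := by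
  have hc : Continuous fun w => (f w).re := Complex.continuous_re.comp hf.continuous
  obtain ⟨w₀, hw₀⟩ := hunb (max N 0)
  obtain ⟨hN, h0⟩ := max_lt_iff.1 hw₀
  have hdist := dist_nonneg (x := w₀) (y := z₀)
  obtain ⟨z, w, hz, hzR, hw, hmax⟩ := exists_zero_forall_le hc hz₀
    (R := ‖z₀‖ + 8 * dist w₀ z₀) (by linarith)
  set R := ‖z₀‖ + 8 * dist w₀ z₀ with hR
  have hF : (f w₀).re ≤ (f w).re := hmax z₀ w₀ hz₀ (by linarith) (by linarith)
  have hFpos : 0 < (f w).re := h0.trans_le hF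
  obtain ⟨ρ, hρ⟩ : ∃ ρ, ρ = (R - ‖z‖) / 8 := ⟨_, rfl⟩
  rw [← hρ] at hw
  have hρ0 : 0 < ρ := by
    rcases (dist_nonneg.trans hw).eq_or_lt with h | h
    · rw [← h] at hw
      rw [dist_le_zero.1 hw, hz] at hFpos
      exact absurd hFpos (lt_irrefl 0)
    · exact h
  have hgrow : ∀ y, dist y z ≤ ρ * (8 / 3) → (f y).re ≤ 3 ^ 14 * (f w).re := fun y hy =>
    re_le_pow_mul_of_forall_zero hf hFpos.le hρ0 hz hρ hmax 14 le_rfl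
      (by push_cast; linarith)
  refine ⟨z, 4 / 3 * ρ, by positivity, hz,
    (hN.le.trans hF).trans (le_supOn hc (by linarith)), ?_⟩
  have hsup : (f w).re ≤ supOn (fun w => (f w).re) z (3 / 4 * (4 / 3 * ρ)) :=
    le_supOn hc (by linarith)
  refine supOn_le (by positivity) fun y hy => ?_
  have h1 := hgrow y (by linarith)
  have h2 := sub_re_le_of_forall_re_le hf (A := 3 ^ 14 * (f w).re) (R := ρ * (8 / 3)) (c := z)
    (w := y) (by positivity) (by rw [hz]; positivity)
    (fun x hx => hgrow x (mem_ball.1 hx).le) (by linarith)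
  rw [hz] at h2
  exact abs_le.2 ⟨by linarith, by linarith⟩

/-- **Corollary 3.4.** There is an absolute constant `C₀ > 0` such that for every nonconstant
entire harmonic `u` there are discs `D(z_n, r_n)` with `u(z_n) = 0`, `M(u,z_n,r_n) → ∞` and
`M(|u|,z_n,r_n) ≤ C₀·M(u,z_n,(3/4)·r_n)`. -/
theorem lewis_discs_sequence_abs :
    ∃ C₀ : ℝ, 0 < C₀ ∧ ∀ u : ℂ → ℝ, HarmonicFn u → (¬ ∃ c : ℝ, ∀ z, u z = c) →
      ∃ z : ℕ → ℂ, ∃ r : ℕ → ℝ, (∀ n, 0 < r n) ∧ (∀ n, u (z n) = 0) ∧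
        Tendsto (fun n => supOn u (z n) (r n)) atTop atTop ∧
        ∀ n, supOn (fun w => |u w|) (z n) (r n) ≤ C₀ * supOn u (z n) (3 / 4 * r n) := by
  refine ⟨2 * 3 ^ 14, by norm_num, fun u hu hconst => ?_⟩
  obtain ⟨f, hf, hfu⟩ := hu.exists_re_eq
  obtain rfl : u = fun z => (f z).re := funext hfu
  have hunb : ∀ M, ∃ z, M < (f z).re := by
    by_contra! h
    obtain ⟨M, hM⟩ := h
    exact hconst ⟨_, fun z => re_eq_of_forall_re_le hf hM z 0⟩
  have hunb' : ∃ z, (f z).re < 0 := by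
    by_contra! h
    refine hconst ⟨(f 0).re, fun z => ?_⟩
    simpa using re_eq_of_forall_re_le hf.neg (M := 0) (fun z => by simpa using h z) z 0
  obtain ⟨a, ha⟩ := hunb'
  obtain ⟨b, hb⟩ := hunb 0
  obtain ⟨z₀, hz₀⟩ := intermediate_value_univ a b
    (Complex.continuous_re.comp hf.continuous) ⟨ha.le, hb.le⟩
  choose z r hr hz hlarge hdouble using
    fun n : ℕ => exists_doubling_disc hf hunb hz₀ n
  exact ⟨z, r, hr, hz, tendsto_atTop_mono hlarge tendsto_natCast_atTop_atTop, hdouble⟩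
end

section
/- Let f = u + iv : ℂ → ℂ be a harmonic map, let {z_k} ⊆ ℂ, let {r_k} and {M_k} be sequences of positive reals with M_k → +∞, and let F = U + iV : 𝔻 → ℂ (with U, V harmonic on the open unit disc 𝔻) be such that for every z ∈ 𝔻, ( u(z_k + r_k z) + i·v(z_k + r_k z) ) / M_k → F(z) as k → ∞. Then F(𝔻) ⊆ { r·e^{iθ} : r ≥ 0, e^{iθ} ∈ D(R_f) }; that is, every nonzero value of F lies on a ray from the origin in an asymptotic direction of R_f. -/
open Complex Metric Filter Set

/-- **Proposition 4.2.** If `F = U + iV` on the unit disc is a rescaled limit of the harmonic map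
`f = u + iv` (that is, `(u(z_k + r_k z) + i v(z_k + r_k z))/M_k → F(z)` with `M_k → ∞`), then
every nonzero value of `F` lies on a ray from the origin in an asymptotic direction of the range
of `f`. -/
theorem rescaled_range_in_asymptotic_rays
    (u v : ℂ → ℝ) (hu : HarmonicFn u) (hv : HarmonicFn v)
    (f : ℂ → ℂ) (hf : ∀ z, f z = (u z : ℂ) + (v z : ℂ) * Complex.I)
    (zk : ℕ → ℂ) (rk Mk : ℕ → ℝ) (hrk : ∀ k, 0 < rk k) (hMk : ∀ k, 0 < Mk k)
    (hMktop : Tendsto Mk atTop atTop)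
    (U V : ℂ → ℝ) (hU : HarmonicOnSet U (Metric.ball 0 1)) (hV : HarmonicOnSet V (Metric.ball 0 1))
    (F : ℂ → ℂ) (hF : ∀ z, F z = (U z : ℂ) + (V z : ℂ) * Complex.I)
    (hconv : ∀ z ∈ Metric.ball (0 : ℂ) 1,
      Tendsto (fun k =>
          ((u (zk k + (rk k : ℂ) * z) : ℂ) + (v (zk k + (rk k : ℂ) * z) : ℂ) * Complex.I)
            / (Mk k : ℂ))
        atTop (nhds (F z))) :
    ∀ z ∈ Metric.ball (0 : ℂ) 1, F z ≠ 0 →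
      ∃ r : ℝ, 0 ≤ r ∧ ∃ ζ ∈ asympDirs (Set.range f), F z = (r : ℂ) * ζ := by
  intro z hz hne
  have hr : 0 < ‖F z‖ := norm_pos_iff.mpr hne
  have hrC : (‖F z‖ : ℂ) ≠ 0 := by exact_mod_cast hr.ne'
  refine ⟨‖F z‖, hr.le, F z / ‖F z‖, ⟨?_, fun k => f (zk k + (rk k : ℂ) * z),
    fun k => mem_range_self _, fun k => (Mk k)⁻¹ * ‖F z‖⁻¹,
    fun k => mul_pos (inv_pos.mpr (hMk k)) (inv_pos.mpr hr), ?_, ?_⟩, (mul_div_cancel₀ _ hrC).symm⟩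
  · rw [norm_div, norm_real, norm_norm, div_self hr.ne']
  · simpa using hMktop.inv_tendsto_atTop.mul_const ‖F z‖⁻¹
  · refine ((hconv z hz).div_const (‖F z‖ : ℂ)).congr fun k => ?_
    simp only [hf]
    push_cast
    ring
end
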